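/- Let 1 ≤ n ≤ 6. Let a_1, …, a_n be positive integers and, for each ε ∈ {0,1}^n, let b_ε be a positive integer, such that b_ε + b_{ε'} < a_i whenever ε, ε' ∈ {0,1}^n differ exactly in the i-th coordinate. Let P = {x ∈ ℝ^n : 0 ≤ x_i ≤ a_i for all i, and for every ε ∈ {0,1}^n, Σ_{i=1}^n (ε_i(a_i − x_i) + (1 − ε_i)x_i) ≥ b_ε}. Then there exists a polynomial p ∈ ℚ[t] with p(t) = |tP ∩ ℤ^n| for every positive integer t, and every coefficient of p is strictly positive. -/

import Mathlib

open Pointwise Polynomial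

/-- The canonical embedding of integer vectors into real vectors. -/
def intVec {n : ℕ} (z : Fin n → ℤ) : Fin n → ℝ := fun i => (z i : ℝ)

/-- The number of lattice points `|tP ∩ ℤ^n|` in the `t`-th dilate of `P ⊆ ℝ^n`. -/
noncomputable def latticePointCount {n : ℕ} (P : Set (Fin n → ℝ)) (t : ℕ) : ℕ :=
  {z : Fin n → ℤ | intVec z ∈ (t : ℝ) • P}.ncard

/-- The box `∏_i [0, a_i]` with each vertex `(ε_1 a_1, …, ε_n a_n)` chiseled off at
lattice distance `b ε`. -/
def genChiseledBox (n : ℕ) (a : Fin n → ℕ) (b : (Fin n → Bool) → ℕ) :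
    Set (Fin n → ℝ) :=
  {x | (∀ i, 0 ≤ x i ∧ x i ≤ (a i : ℝ)) ∧
    ∀ ε : Fin n → Bool, (b ε : ℝ) ≤ ∑ i, if ε i then (a i : ℝ) - x i else x i}

/-- The `ℓ¹`-distance from a point `z` of the box `∏_i [0, A_i]` to its vertex `ε`. -/
def cornerDist {n : ℕ} (A : Fin n → ℤ) (ε : Fin n → Bool) (z : Fin n → ℤ) : ℤ :=
  ∑ i, if ε i then A i - z i else z i

/-- The lattice points of the box `∏_i [0, A_i]` at distance less than `M` from the vertex `ε`. -/
noncomputable def cornerPoints {n : ℕ} (A : Fin n → ℤ) (ε : Fin n → Bool) (M : ℤ) : Finset (Fin n → ℤ) :=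
  {z ∈ Finset.Icc 0 A | cornerDist A ε z < M}

theorem mem_cornerPoints {n : ℕ} {A : Fin n → ℤ} {ε : Fin n → Bool} {M : ℤ} {z : Fin n → ℤ} :
    z ∈ cornerPoints A ε M ↔ (∀ i, 0 ≤ z i ∧ z i ≤ A i) ∧ cornerDist A ε z < M := by
  simp [cornerPoints, Pi.le_def, forall_and]

/-- A corner simplex of side `m + 1` that fits in the box has `(n + m).choose n` lattice points. -/
theorem card_cornerPoints {n : ℕ} (A : Fin n → ℤ) (ε : Fin n → Bool) (m : ℕ)
    (hm : ∀ i, (m : ℤ) ≤ A i) :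
    (cornerPoints A ε (m + 1)).card = (n + m).choose n := by
  have hcard : (Finset.finsuppAntidiag (Finset.univ : Finset (Option (Fin n))) m).card
      = (n + m).choose n := by
    rw [Finset.card_finsuppAntidiag_nat_eq_choose, Finset.card_univ, Fintype.card_option,
      Fintype.card_fin, show n + 1 + m - 1 = n + m by omega, Nat.choose_symm_add]
  rw [← hcard]
  symm
  have hsum : ∀ f ∈ Finset.finsuppAntidiag (Finset.univ : Finset (Option (Fin n))) m,
      f none + ∑ i, f (some i) = m := by
    intro f hf
    simpa [Finset.mem_finsuppAntidiag, Fintype.sum_option] using hf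
  refine Finset.card_bij
    (fun f _ i => if ε i then A i - (f (some i) : ℤ) else (f (some i) : ℤ)) ?_ ?_ ?_
  · intro f hf
    have h := hsum f hf
    rw [mem_cornerPoints]
    constructor
    · intro i
      have h1 : f (some i) ≤ ∑ i, f (some i) :=
        Finset.single_le_sum (f := fun i => f (some i)) (fun _ _ => Nat.zero_le _)
          (Finset.mem_univ i)
      have := hm i
      split_ifs <;> omega
    · have : cornerDist A ε (fun i => if ε i then A i - (f (some i) : ℤ) else (f (some i) : ℤ))
          = ((∑ i, f (some i) : ℕ) : ℤ) := by
        rw [cornerDist, Nat.cast_sum]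
        refine Finset.sum_congr rfl fun i _ => ?_
        split_ifs <;> ring
      omega
  · intro f hf g hg hfg
    have key : ∀ i, f (some i) = g (some i) := by
      intro i
      have := congrFun hfg i
      split_ifs at this <;> omega
    have hf' := hsum f hf
    have hg' := hsum g hg
    simp only [key] at hf'
    ext (_ | i)
    · omega
    · exact key i
  · intro z hz
    rw [mem_cornerPoints] at hz
    obtain ⟨hz, hd⟩ := hz
    have hy : ∀ i, (((if ε i then A i - z i else z i).toNat : ℕ) : ℤ)
        = if ε i then A i - z i else z i := by
      intro i
      have := hz i
      split_ifs <;> omega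
    have hS : ((∑ i, (if ε i then A i - z i else z i).toNat : ℕ) : ℤ) = cornerDist A ε z := by
      rw [Nat.cast_sum, cornerDist]
      exact Finset.sum_congr rfl fun i _ => hy i
    refine ⟨Finsupp.equivFunOnFinite.symm (fun o => o.elim
      (m - ∑ i, (if ε i then A i - z i else z i).toNat)
      (fun i => (if ε i then A i - z i else z i).toNat)), ?_, ?_⟩
    · simp only [Finset.mem_finsuppAntidiag, Finset.subset_univ, and_true,
        Finsupp.equivFunOnFinite_symm_apply_apply, Fintype.sum_option, Option.elim]
      omega
    · funext i
      simp only [Finsupp.equivFunOnFinite_symm_apply_apply, Option.elim]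
      rw [hy i]
      split_ifs <;> ring

/-- Two corner simplices of the box are disjoint when the sums of sides along edges are at most
the edge lengths. -/
theorem disjoint_cornerPoints {n : ℕ} {A : Fin n → ℤ} {M : (Fin n → Bool) → ℤ}
    (hM : ∀ ε, 0 ≤ M ε)
    (hMA : ∀ (ε : Fin n → Bool) (i : Fin n), M ε + M (Function.update ε i (!ε i)) ≤ A i)
    {ε δ : Fin n → Bool} (h : ε ≠ δ) :
    Disjoint (cornerPoints A ε (M ε)) (cornerPoints A δ (M δ)) := by
  rw [Finset.disjoint_left]
  intro z hε hδ
  rw [mem_cornerPoints] at hε hδ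
  obtain ⟨hz, hε⟩ := hε
  have hδ := hδ.2
  have hterm : ∀ i, 0 ≤ (if ε i then A i - z i else z i) + (if δ i then A i - z i else z i) := by
    intro i
    have := hz i
    split_ifs <;> omega
  have hne : ∀ i, ε i ≠ δ i →
      (if ε i then A i - z i else z i) + (if δ i then A i - z i else z i) = A i := by
    intro i hi
    cases h1 : ε i <;> cases h2 : δ i <;> simp_all
  have hd : cornerDist A ε z + cornerDist A δ z
      = ∑ i, ((if ε i then A i - z i else z i) + (if δ i then A i - z i else z i)) := by
    rw [Finset.sum_add_distrib, cornerDist, cornerDist]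
  obtain ⟨i, hi⟩ := Function.ne_iff.mp h
  by_cases hex : ∃ j, j ≠ i ∧ ε j ≠ δ j
  · obtain ⟨j, hji, hj⟩ := hex
    have hle := Finset.sum_le_sum_of_subset_of_nonneg (Finset.subset_univ {j, i})
      (fun k _ _ => hterm k)
    rw [Finset.sum_pair hji, hne i hi, hne j hj, ← hd] at hle
    have := hMA ε i
    have := hMA δ j
    have := hM (Function.update ε i (!ε i))
    have := hM (Function.update δ j (!δ j))
    omega
  · push Not at hex
    have hup : Function.update ε i (!ε i) = δ := by
      funext j
      by_cases hji : j = i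
      · subst hji
        rw [Function.update_self]
        cases h1 : ε j <;> cases h2 : δ j <;> simp_all
      · rw [Function.update_of_ne hji, hex j hji]
    have hle := Finset.single_le_sum (fun k _ => hterm k) (Finset.mem_univ i)
    rw [hne i hi, ← hd] at hle
    have := hMA ε i
    rw [hup] at this
    omega

theorem intVec_mem_smul_genChiseledBox {n : ℕ} {a : Fin n → ℕ} {b : (Fin n → Bool) → ℕ} {t : ℕ}
    (ht : 0 < t) (z : Fin n → ℤ) :
    intVec z ∈ (t : ℝ) • genChiseledBox n a b ↔
      (∀ i, 0 ≤ z i ∧ z i ≤ (t * a i : ℕ)) ∧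
        ∀ ε, ((t * b ε : ℕ) : ℤ) ≤ cornerDist (fun i => ((t * a i : ℕ) : ℤ)) ε z := by
  have htR : (0 : ℝ) < t := by exact_mod_cast ht
  rw [Set.mem_smul_set_iff_inv_smul_mem₀ htR.ne']
  simp only [genChiseledBox, Set.mem_ofPred_eq, Pi.smul_apply, smul_eq_mul, intVec]
  refine and_congr (forall_congr' fun i => and_congr ?_ ?_) (forall_congr' fun ε => ?_)
  · rw [mul_nonneg_iff_of_pos_left (inv_pos.mpr htR)]
    exact_mod_cast Iff.rfl
  · rw [inv_mul_le_iff₀ htR]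
    exact_mod_cast Iff.rfl
  · have h1 : (∑ i, if ε i = true then (a i : ℝ) - (t : ℝ)⁻¹ * z i else (t : ℝ)⁻¹ * z i)
        = (t : ℝ)⁻¹ * (cornerDist (fun i => ((t * a i : ℕ) : ℤ)) ε z : ℤ) := by
      rw [cornerDist, Int.cast_sum, Finset.mul_sum]
      refine Finset.sum_congr rfl fun i _ => ?_
      split_ifs
      · push_cast
        field_simp
      · rfl
    rw [h1, le_inv_mul_iff₀ htR]
    exact_mod_cast Iff.rfl

/-- The lattice points of a dilate of the chiseled box are those of the box outside the corner
simplices. -/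
theorem latticePointCount_genChiseledBox {n : ℕ} {a : Fin n → ℕ} {b : (Fin n → Bool) → ℕ}
    (hb : ∀ ε, 0 < b ε)
    (hba : ∀ (ε : Fin n → Bool) (i : Fin n), b ε + b (Function.update ε i (!ε i)) < a i)
    {t : ℕ} (ht : 0 < t) :
    latticePointCount (genChiseledBox n a b) t + ∑ ε, (n + (t * b ε - 1)).choose n
      = ∏ i, (t * a i + 1) := by
  set A : Fin n → ℤ := fun i => ((t * a i : ℕ) : ℤ) with hA
  set M : (Fin n → Bool) → ℤ := fun ε => ((t * b ε : ℕ) : ℤ) with hM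
  set U : Finset (Fin n → ℤ) := Finset.univ.biUnion fun ε => cornerPoints A ε (M ε) with hU
  have hUsub : U ⊆ Finset.Icc 0 A :=
    Finset.biUnion_subset.mpr fun ε _ => Finset.filter_subset _ _
  have hcount : latticePointCount (genChiseledBox n a b) t = (Finset.Icc 0 A \ U).card := by
    rw [latticePointCount, ← Set.ncard_coe_finset]
    congr 1
    ext z
    rw [Set.mem_ofPred_eq, intVec_mem_smul_genChiseledBox ht, Finset.mem_coe, Finset.mem_sdiff]
    have : z ∈ Finset.Icc 0 A ↔ ∀ i, 0 ≤ z i ∧ z i ≤ A i := by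
      simp [Pi.le_def, forall_and]
    rw [this]
    refine and_congr_right fun hz => ?_
    simp only [hU, Finset.mem_biUnion, Finset.mem_univ, true_and, mem_cornerPoints, not_exists,
      not_and, not_lt]
    exact forall_congr' fun ε => ⟨fun h _ => h, fun h => h hz⟩
  have hMA : ∀ (ε : Fin n → Bool) (i : Fin n), M ε + M (Function.update ε i (!ε i)) ≤ A i := by
    intro ε i
    have := Nat.mul_le_mul_left t (hba ε i).le
    rw [mul_add] at this
    simp only [hA, hM]
    exact_mod_cast this
  have hUcard : U.card = ∑ ε, (n + (t * b ε - 1)).choose n := by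
    rw [hU, Finset.card_biUnion fun ε _ δ _ h =>
      disjoint_cornerPoints (fun ε => Int.natCast_nonneg _) hMA h]
    refine Finset.sum_congr rfl fun ε _ => ?_
    have hpos : 0 < t * b ε := Nat.mul_pos ht (hb ε)
    have hMε : M ε = ((t * b ε - 1 : ℕ) : ℤ) + 1 := by simp only [hM]; omega
    change (cornerPoints A ε (M ε)).card = _
    rw [hMε]
    refine card_cornerPoints A ε _ fun i => ?_
    have h1 := hMA ε i
    have h2 : 0 ≤ M (Function.update ε i (!ε i)) := Int.natCast_nonneg _
    omega
  have hbox : (Finset.Icc 0 A).card = ∏ i, (t * a i + 1) := by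
    rw [Pi.card_Icc]
    refine Finset.prod_congr rfl fun i _ => ?_
    rw [Int.card_Icc]
    simp only [hA, Pi.zero_apply]
    omega
  rw [hcount, ← hUcard, ← hbox, Finset.card_sdiff_add_card_eq_card hUsub]

/-- The Ehrhart polynomial of the chiseled box. -/
noncomputable def chiseledBoxEhrhart (n : ℕ) (a : Fin n → ℕ) (b : (Fin n → Bool) → ℕ) : ℚ[X] :=
  ∏ i, (1 + C (a i : ℚ) * X) -
    C ((n.factorial : ℚ)⁻¹) * ∑ ε, (ascPochhammer ℚ n).comp (C (b ε : ℚ) * X)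

theorem eval_chiseledBoxEhrhart {n : ℕ} {a : Fin n → ℕ} {b : (Fin n → Bool) → ℕ}
    (hb : ∀ ε, 0 < b ε)
    (hba : ∀ (ε : Fin n → Bool) (i : Fin n), b ε + b (Function.update ε i (!ε i)) < a i)
    {t : ℕ} (ht : 0 < t) :
    (chiseledBoxEhrhart n a b).eval (t : ℚ) = latticePointCount (genChiseledBox n a b) t := by
  have h := congrArg (Nat.cast : ℕ → ℚ) (latticePointCount_genChiseledBox hb hba ht)
  push_cast at h
  rw [← eq_sub_iff_add_eq] at h
  rw [h, chiseledBoxEhrhart, eval_sub, eval_prod, eval_mul, eval_C, eval_finsetSum,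
    Finset.mul_sum]
  congr 1
  · refine Finset.prod_congr rfl fun i _ => ?_
    simp only [eval_add, eval_one, eval_mul, eval_C, eval_X]
    ring
  · refine Finset.sum_congr rfl fun ε _ => ?_
    obtain ⟨m, hm⟩ : ∃ m, t * b ε = m + 1 :=
      Nat.exists_eq_add_of_le' (Nat.mul_pos ht (hb ε))
    have he : (C (b ε : ℚ) * X).eval (t : ℚ) = ((m + 1 : ℕ) : ℚ) := by
      rw [← hm]
      simp [mul_comm]
    rw [eval_comp, he, ascPochhammer_nat_eq_natCast_ascFactorial,
      Nat.ascFactorial_eq_factorial_mul_choose, hm, Nat.add_sub_cancel, Nat.cast_mul,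
      inv_mul_cancel_left₀ (Nat.cast_ne_zero.mpr n.factorial_ne_zero), add_comm m n]

theorem coeff_ascPochhammer (n j : ℕ) :
    (ascPochhammer ℚ n).coeff j = Nat.stirlingFirst n j := by
  induction n generalizing j with
  | zero => cases j <;> simp [Polynomial.coeff_one]
  | succ n ih =>
    rw [ascPochhammer_succ_right, mul_add, coeff_add, ← C_eq_natCast, coeff_mul_C]
    cases j with
    | zero => cases n <;> simp [ih]
    | succ j =>
      rw [coeff_mul_X, ih, ih, Nat.stirlingFirst_succ_succ]
      push_cast
      ring

/-- The elementary symmetric functions of numbers that are at least `m` are at least those of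
constants `m`. -/
theorem choose_mul_pow_le_coeff_prod {ι : Type*} (s : Finset ι) (a : ι → ℚ) {m : ℚ} (hm : 0 ≤ m)
    (ha : ∀ i ∈ s, m ≤ a i) (j : ℕ) :
    (s.card.choose j : ℚ) * m ^ j ≤ (∏ i ∈ s, (1 + C (a i) * X)).coeff j := by
  classical
  induction s using Finset.induction_on generalizing j with
  | empty => cases j <;> simp [Polynomial.coeff_one]
  | insert i s hi ih =>
    have ih := ih fun k hk => ha k (Finset.mem_insert_of_mem hk)
    rw [Finset.prod_insert hi, Finset.card_insert_of_notMem hi, add_mul, one_mul, coeff_add,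
      mul_assoc, coeff_C_mul]
    cases j with
    | zero => simpa using ih 0
    | succ j =>
      rw [coeff_X_mul, Nat.choose_succ_succ, Nat.cast_add, add_mul, add_comm]
      refine add_le_add (ih _) ?_
      calc (s.card.choose j : ℚ) * m ^ (j + 1) = m * (s.card.choose j * m ^ j) := by ring
        _ ≤ _ := mul_le_mul (ha i (Finset.mem_insert_self i s)) (ih j) (by positivity)
          (hm.trans (ha i (Finset.mem_insert_self i s)))

theorem sum_pow_lt_of_add_update_lt {n : ℕ} {b : (Fin n → Bool) → ℕ} {i : Fin n} {m j : ℕ}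
    (hj : j ≠ 0) (h : ∀ ε : Fin n → Bool, b ε + b (Function.update ε i (!ε i)) < m) :
    2 * ∑ ε, b ε ^ j < 2 ^ n * m ^ j := by
  have hinv : Function.Involutive fun ε : Fin n → Bool => Function.update ε i (!ε i) := by
    intro ε
    simp
  have hswap : ∑ ε, b (Function.update ε i (!ε i)) ^ j = ∑ ε, b ε ^ j :=
    Equiv.sum_comp hinv.toPerm fun ε => b ε ^ j
  calc 2 * ∑ ε, b ε ^ j = ∑ ε, (b ε ^ j + b (Function.update ε i (!ε i)) ^ j) := by
        rw [Finset.sum_add_distrib, hswap, two_mul]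
    _ < ∑ _ε : Fin n → Bool, m ^ j := Finset.sum_lt_sum_of_nonempty Finset.univ_nonempty
        fun ε _ => (pow_add_pow_le (Nat.zero_le _) (Nat.zero_le _) hj).trans_lt
          (Nat.pow_lt_pow_left (h ε) hj)
    _ = 2 ^ n * m ^ j := by simp

theorem two_pow_mul_stirlingFirst_le {n j : ℕ} (hn : n ≤ 6) (hj : j ≤ n) (hj0 : j ≠ 0) :
    2 ^ n * n.stirlingFirst j ≤ 2 * (n.factorial * n.choose j) := by
  revert hj0 hj
  revert j
  interval_cases n <;> decide

theorem coeff_chiseledBoxEhrhart_pos {n : ℕ} (hn1 : 1 ≤ n) (hn6 : n ≤ 6) {a : Fin n → ℕ}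
    {b : (Fin n → Bool) → ℕ}
    (hba : ∀ (ε : Fin n → Bool) (i : Fin n), b ε + b (Function.update ε i (!ε i)) < a i)
    {j : ℕ} (hj : j ≤ n) : 0 < (chiseledBoxEhrhart n a b).coeff j := by
  have hcoeff : (chiseledBoxEhrhart n a b).coeff j = (∏ i, (1 + C (a i : ℚ) * X)).coeff j -
      (n.factorial : ℚ)⁻¹ * (n.stirlingFirst j * ∑ ε, (b ε : ℚ) ^ j) := by
    rw [chiseledBoxEhrhart, coeff_sub, coeff_C_mul, finsetSum_coeff]
    simp only [comp_C_mul_X_coeff, coeff_ascPochhammer, Finset.mul_sum]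
  have : Nonempty (Fin n) := ⟨⟨0, hn1⟩⟩
  obtain ⟨i, -, hi⟩ := Finset.exists_min_image Finset.univ a Finset.univ_nonempty
  have hprod := choose_mul_pow_le_coeff_prod Finset.univ (fun k => (a k : ℚ))
    (Nat.cast_nonneg (a i)) (fun k hk => Nat.cast_le.mpr (hi k hk)) j
  rw [Finset.card_univ, Fintype.card_fin] at hprod
  rw [hcoeff, sub_pos]
  refine lt_of_lt_of_le ?_ hprod
  rw [inv_mul_lt_iff₀ (Nat.cast_pos.mpr n.factorial_pos)]
  have ha : 0 < a i := (Nat.zero_le _).trans_lt (hba (fun _ => false) i)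
  have hfact := n.factorial_pos
  have hchoose := Nat.choose_pos hj
  rcases eq_or_ne j 0 with rfl | hj0
  · obtain ⟨k, rfl⟩ := Nat.exists_eq_add_of_le' hn1
    simp only [Nat.stirlingFirst_succ_zero, Nat.cast_zero, zero_mul]
    positivity
  · have hsum := sum_pow_lt_of_add_update_lt hj0 fun ε => hba ε i
    have hnum := two_pow_mul_stirlingFirst_le hn6 hj hj0
    have key : n.stirlingFirst j * ∑ ε, b ε ^ j
        < n.factorial * (n.choose j * a i ^ j) := by
      rcases Nat.eq_zero_or_pos (n.stirlingFirst j) with h0 | hpos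
      · rw [h0, zero_mul]
        positivity
      · have h1 := Nat.mul_lt_mul_of_pos_left hsum hpos
        have h2 := Nat.mul_le_mul_right (a i ^ j) hnum
        nlinarith
    exact_mod_cast key

theorem natDegree_chiseledBoxEhrhart_le (n : ℕ) (a : Fin n → ℕ) (b : (Fin n → Bool) → ℕ) :
    (chiseledBoxEhrhart n a b).natDegree ≤ n := by
  have hlin : ∀ c : ℚ, (C c * X).natDegree ≤ 1 := fun c =>
    natDegree_C_mul_le c X |>.trans natDegree_X_le
  refine (natDegree_sub_le _ _).trans (max_le ?_ ((natDegree_C_mul_le _ _).trans ?_))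
  · refine (natDegree_prod_le _ _).trans ((Finset.sum_le_card_nsmul _ _ 1 fun i _ => ?_).trans ?_)
    · exact natDegree_add_le_of_degree_le (by simp) (hlin _)
    · simp
  · refine natDegree_sum_le_of_forall_le _ _ fun ε _ => ?_
    refine natDegree_comp_le.trans ?_
    rw [ascPochhammer_natDegree]
    exact (Nat.mul_le_mul_left n (hlin _)).trans (mul_one n).le

/-- For `1 ≤ n ≤ 6`, any lattice polytope obtained from a box `∏_i [0,a_i]` by
chiseling off each vertex `ε` at distance `b ε` (with `b ε + b ε' < a i` whenever
`ε, ε'` differ exactly in coordinate `i`) has an Ehrhart polynomial with only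
strictly positive coefficients. -/
theorem genChiseledBox_ehrhart_positive (n : ℕ) (hn1 : 1 ≤ n) (hn6 : n ≤ 6)
    (a : Fin n → ℕ) (ha : ∀ i, 0 < a i) (b : (Fin n → Bool) → ℕ) (hb : ∀ ε, 0 < b ε)
    (hba : ∀ (ε : Fin n → Bool) (i : Fin n),
      b ε + b (Function.update ε i (!ε i)) < a i) :
    ∃ p : Polynomial ℚ,
      (∀ t : ℕ, 0 < t → p.eval (t : ℚ) = latticePointCount (genChiseledBox n a b) t) ∧
      ∀ j ≤ p.natDegree, 0 < p.coeff j := by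
  exact ⟨chiseledBoxEhrhart n a b, fun t ht => eval_chiseledBoxEhrhart hb hba ht,
    fun j hj => coeff_chiseledBoxEhrhart_pos hn1 hn6 hba
      (hj.trans (natDegree_chiseledBoxEhrhart_le n a b))⟩
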